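/- For every finite simple graph G of order n ≥ 4 (not necessarily connected), 7 ≤ γ_qtR(G) + γ_qtR(Ḡ) ≤ n + 5, where Ḡ denotes the complement of G. -/

import Mathlib

/-- A Roman dominating function: labels in {0,1,2}, and every vertex labeled 0
has a neighbor labeled 2. -/
def IsRDF {V : Type*} (G : SimpleGraph V) (f : V → ℕ) : Prop :=
  (∀ v, f v ≤ 2) ∧ ∀ u, f u = 0 → ∃ v, G.Adj u v ∧ f v = 2

/-- A quasi-total Roman dominating function: an RDF such that every vertex labeled 2
has a neighbor with positive label. -/
def IsQTRDF {V : Type*} (G : SimpleGraph V) (f : V → ℕ) : Prop :=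
  IsRDF G f ∧ ∀ x, f x = 2 → ∃ y, G.Adj x y ∧ 1 ≤ f y

/-- A total Roman dominating function: an RDF such that every vertex with positive label
has a neighbor with positive label. -/
def IsTRDF {V : Type*} (G : SimpleGraph V) (f : V → ℕ) : Prop :=
  IsRDF G f ∧ ∀ v, 1 ≤ f v → ∃ w, G.Adj v w ∧ 1 ≤ f w

/-- The Roman domination number. -/
noncomputable def gammaR {V : Type*} [Fintype V] (G : SimpleGraph V) : ℕ :=
  sInf {w | ∃ f : V → ℕ, IsRDF G f ∧ ∑ v, f v = w}

/-- The quasi-total Roman domination number. -/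
noncomputable def gammaQTR {V : Type*} [Fintype V] (G : SimpleGraph V) : ℕ :=
  sInf {w | ∃ f : V → ℕ, IsQTRDF G f ∧ ∑ v, f v = w}

/-- The total Roman domination number. -/
noncomputable def gammaTR {V : Type*} [Fintype V] (G : SimpleGraph V) : ℕ :=
  sInf {w | ∃ f : V → ℕ, IsTRDF G f ∧ ∑ v, f v = w}

/-- A dominating set: every vertex outside it has a neighbor in it. -/
def IsDomSet {V : Type*} (G : SimpleGraph V) (D : Finset V) : Prop :=
  ∀ v ∉ D, ∃ u ∈ D, G.Adj v u

/-- The domination number. -/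
noncomputable def gammaDom {V : Type*} [Fintype V] (G : SimpleGraph V) : ℕ :=
  sInf {n | ∃ D : Finset V, IsDomSet G D ∧ D.card = n}

/-- A total dominating set: every vertex has a neighbor in it. -/
def IsTotalDomSet {V : Type*} (G : SimpleGraph V) (D : Finset V) : Prop :=
  ∀ v, ∃ u ∈ D, G.Adj v u

/-- The total domination number. -/
noncomputable def gammaT {V : Type*} [Fintype V] (G : SimpleGraph V) : ℕ :=
  sInf {n | ∃ D : Finset V, IsTotalDomSet G D ∧ D.card = n}

/-- A packing: a set of vertices whose closed neighborhoods are pairwise disjoint. -/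
def IsPacking {V : Type*} (G : SimpleGraph V) (B : Finset V) : Prop :=
  ∀ u ∈ B, ∀ v ∈ B, u ≠ v →
    ∀ w, ¬ ((w = u ∨ G.Adj u w) ∧ (w = v ∨ G.Adj v w))

/-- The packing number. -/
noncomputable def packingNumber {V : Type*} [Fintype V] (G : SimpleGraph V) : ℕ :=
  sSup {n | ∃ B : Finset V, IsPacking G B ∧ B.card = n}

theorem isQTRDF_one {V : Type*} (G : SimpleGraph V) : IsQTRDF G (fun _ => 1) :=
  ⟨⟨fun _ => by norm_num, fun _ h => by simp at h⟩, fun _ h => by simp at h⟩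

theorem gammaQTR_le_sum {V : Type*} [Fintype V] {G : SimpleGraph V} {f : V → ℕ}
    (hf : IsQTRDF G f) : gammaQTR G ≤ ∑ v, f v :=
  Nat.sInf_le ⟨f, hf, rfl⟩

theorem exists_isQTRDF_sum_eq_gammaQTR {V : Type*} [Fintype V] (G : SimpleGraph V) :
    ∃ f : V → ℕ, IsQTRDF G f ∧ ∑ v, f v = gammaQTR G :=
  Nat.sInf_mem (s := {w | ∃ f : V → ℕ, IsQTRDF G f ∧ ∑ v, f v = w}) ⟨_, _, isQTRDF_one G, rfl⟩

open Classical in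
theorem gammaQTR_add_degree_le {V : Type*} [Fintype V] (G : SimpleGraph V) (v : V) :
    gammaQTR G + G.degree v ≤ Fintype.card V + 2 := by
  rcases Nat.eq_zero_or_pos (G.degree v) with h0 | hpos
  · have := gammaQTR_le_sum (isQTRDF_one G)
    simp only [Finset.sum_const, Finset.card_univ, smul_eq_mul, mul_one] at this
    omega
  obtain ⟨u, hu⟩ := (G.degree_pos_iff_exists_adj v).1 hpos
  have huv : u ≠ v := hu.ne'
  let f : V → ℕ := fun x => if x = v then 2 else if x = u then 1 else if G.Adj v x then 0 else 1
  have hf : IsQTRDF G f := by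
    refine ⟨⟨fun x => ?_, fun x hx => ⟨v, ?_, by simp [f]⟩⟩, fun x hx => ⟨u, ?_, by simp [f, huv]⟩⟩
    · simp only [f]; split_ifs <;> omega
    · simp only [f] at hx
      split_ifs at hx with h₁ h₂ h₃
      exact h₃.symm
    · simp only [f] at hx
      split_ifs at hx with h₁ <;> first | omega | exact h₁ ▸ hu
  have hdeg : G.degree v = ∑ x, if G.Adj v x then 1 else 0 := by
    rw [← G.card_neighborFinset_eq_degree, G.neighborFinset_eq_filter, Finset.card_filter]
  have hsum : ∑ x, (f x + if G.Adj v x then 1 else 0) ≤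
      ∑ x, (1 + (if x = v then 1 else 0) + if x = u then 1 else 0) := by
    refine Finset.sum_le_sum fun x _ => ?_
    simp only [f]
    split_ifs <;> simp_all
  simp only [Finset.sum_add_distrib, ← hdeg, Finset.sum_ite_eq', Finset.mem_univ, if_true,
    Finset.sum_const, Finset.card_univ, smul_eq_mul, mul_one] at hsum
  have := gammaQTR_le_sum hf
  omega

open Classical in
theorem three_le_gammaQTR_and_exists_universal {V : Type*} [Fintype V] (G : SimpleGraph V)
    (hcard : 4 ≤ Fintype.card V) :
    3 ≤ gammaQTR G ∧ (gammaQTR G = 3 → ∃ v, ∀ x, x ≠ v → G.Adj v x) := by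
  obtain ⟨f, ⟨⟨-, hdom⟩, htot⟩, hw⟩ := exists_isQTRDF_sum_eq_gammaQTR G
  rw [← hw]
  by_cases hz : ∀ x, f x ≠ 0
  · have : ∑ _x : V, 1 ≤ ∑ x, f x :=
      Finset.sum_le_sum fun x _ => Nat.one_le_iff_ne_zero.2 (hz x)
    simp only [Finset.sum_const, Finset.card_univ, smul_eq_mul, mul_one] at this
    exact ⟨by omega, fun h => by omega⟩
  push Not at hz
  obtain ⟨u, hu⟩ := hz
  obtain ⟨v, -, hv⟩ := hdom u hu
  obtain ⟨y, hvy, hy⟩ := htot v hv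
  have hle (s : Finset V) : ∑ x ∈ s, f x ≤ ∑ x, f x :=
    Finset.sum_le_sum_of_subset (Finset.subset_univ s)
  have h₂ := hle {v, y}
  rw [Finset.sum_pair hvy.ne] at h₂
  refine ⟨by omega, fun h => ⟨v, fun x hxv => ?_⟩⟩
  by_cases hxy : x = y
  · exact hxy ▸ hvy
  have h₃ := hle {x, v, y}
  rw [Finset.sum_insert (by simp [hxv, hxy]), Finset.sum_pair hvy.ne] at h₃
  obtain ⟨v', hadj, hv'⟩ := hdom x (by omega)
  rcases eq_or_ne v' v with rfl | hne
  · exact hadj.symm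
  · have h₄ := hle {v', v}
    rw [Finset.sum_pair hne] at h₄
    omega

theorem stmt18 {V : Type*} [Fintype V] (G : SimpleGraph V)
    (hcard : 4 ≤ Fintype.card V) :
    7 ≤ gammaQTR G + gammaQTR Gᶜ ∧ gammaQTR G + gammaQTR Gᶜ ≤ Fintype.card V + 5 := by
  classical
  constructor
  · obtain ⟨h₁, hG⟩ := three_le_gammaQTR_and_exists_universal G hcard
    obtain ⟨h₂, hGc⟩ := three_le_gammaQTR_and_exists_universal Gᶜ hcard
    by_contra hlt
    obtain ⟨a, ha⟩ := hG (by omega)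
    obtain ⟨b, hb⟩ := hGc (by omega)
    by_cases hab : a = b
    · have : Nontrivial V := Fintype.one_lt_card_iff_nontrivial.1 (by omega)
      obtain ⟨x, hx⟩ := exists_ne a
      exact (hb x (hab ▸ hx)).2 (hab ▸ ha x hx)
    · exact (hb a hab).2 (ha b (Ne.symm hab)).symm
  · obtain ⟨v⟩ : Nonempty V := Fintype.card_pos_iff.1 (by omega)
    have h₁ := gammaQTR_add_degree_le G v
    have h₂ := gammaQTR_add_degree_le Gᶜ v
    have hdeg := G.degree_compl v
    have hlt := G.degree_lt_card_verts v
    simp only [← SimpleGraph.card_neighborSet_eq_degree, Fintype.card_eq_nat_card] at *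
    omega
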